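/- Let G be a simple graph on n vertices with two longest paths P and Q such that V(G) = V(P) ∪ V(Q), where P = p₁p₂⋯p_{n−1} (so both P and Q have n − 1 vertices and length n − 2), V(P) \ V(Q) = {p_i} with 1 < i < n − 1, V(Q) \ V(P) = {q}, q is adjacent in G to p_i, and the two edges of Q incident to q join q to p_j and p_k, where 1 < j < k < n − 1 and |i − j| > 1, |k − i| > 1, |k − j| > 1. Then none of the pairs {p_{i−1}, p_{i+1}}, {p₁, p_{n−1}}, {p₁, p_{i+1}}, {p_{i−1}, p_{n−1}} is an edge of Q. -/

import Mathlib

open SimpleGraph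

/-- `P` is a longest path in the simple graph `G`: it is a path, and every path in `G`
has length at most the length of `P`. -/
def IsLongestPath {V : Type*} (G : SimpleGraph V) {u v : V} (P : G.Walk u v) : Prop :=
  P.IsPath ∧ ∀ {a b : V} (Q : G.Walk a b), Q.IsPath → Q.length ≤ P.length

theorem SimpleGraph.Walk.IsPath.exists_isPath_length_succ_of_mem_edges {V : Type*}
    {G : SimpleGraph V} {a b x : V} (hax : G.Adj a x) (hxb : G.Adj x b) {u v : V}
    {Q : G.Walk u v} (hQ : Q.IsPath) (hx : x ∉ Q.support) (hab : s(a, b) ∈ Q.edges) :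
    ∃ R : G.Walk u v, R.IsPath ∧ R.length = Q.length + 1 ∧
      ∀ y ∈ R.support, y = x ∨ y ∈ Q.support := by
  induction Q with
  | nil => simp at hab
  | @cons u w v h Q ih =>
    rw [Walk.cons_isPath_iff] at hQ
    rw [Walk.support_cons, List.mem_cons, not_or] at hx
    rw [Walk.edges_cons, List.mem_cons] at hab
    rcases hab with hab | hab
    · have hadj : G.Adj u x ∧ G.Adj x w := by
        rcases Sym2.eq_iff.mp hab with ⟨rfl, rfl⟩ | ⟨rfl, rfl⟩
        · exact ⟨hax, hxb⟩
        · exact ⟨hxb.symm, hax.symm⟩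
      refine ⟨.cons hadj.1 (.cons hadj.2 Q), ?_, by simp, ?_⟩
      · simp only [Walk.cons_isPath_iff, Walk.support_cons, List.mem_cons, not_or]
        exact ⟨⟨hQ.1, hx.2⟩, hadj.1.ne, hQ.2⟩
      · simp only [Walk.support_cons, List.mem_cons]
        tauto
    · obtain ⟨R, hR, hlen, hsub⟩ := ih hQ.1 hx.2 hab
      refine ⟨.cons h R, ?_, by simp [hlen], ?_⟩
      · rw [Walk.cons_isPath_iff]
        refine ⟨hR, fun hu => ?_⟩
        rcases hsub u hu with rfl | hu
        · exact hx.1 rfl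
        · exact hQ.2 hu
      · simp only [Walk.support_cons, List.mem_cons]
        intro y hy
        rcases hy with hy | hy
        · tauto
        · have := hsub y hy
          tauto

theorem IsLongestPath.length_le_of_isChain {V : Type*} {G : SimpleGraph V} {u v : V}
    {P : G.Walk u v} (hP : IsLongestPath G P) {l : List V} (hl : l.IsChain G.Adj)
    (hnd : l.Nodup) : l.length ≤ P.support.length := by
  obtain rfl | hne := eq_or_ne l []
  · simp
  · have h := hP.2 (.ofSupport l hne hl) (by rwa [Walk.isPath_def, Walk.support_ofSupport])
    rw [Walk.length_ofSupport] at h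
    rw [Walk.length_support]
    omega

/-- Attaching an outside neighbour `q` of an inner vertex `x` of a longest path forbids every edge
that would let a path starting with `q, x` traverse the rest of the longest path. -/
theorem IsLongestPath.not_adj_of_support_eq {V : Type*} {G : SimpleGraph V} {u v : V}
    {P : G.Walk u v} (hP : IsLongestPath G P) {A B : List V} {q x a a' b b' : V}
    (hsupp : P.support = A ++ x :: B) (hq : q ∉ P.support) (hqx : G.Adj q x)
    (ha : A.head? = some a) (ha' : A.getLast? = some a')
    (hb : B.head? = some b) (hb' : B.getLast? = some b') :
    ¬ G.Adj a b' ∧ ¬ G.Adj a b ∧ ¬ G.Adj a' b' := by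
  have hnd : (A ++ x :: B).Nodup := hsupp ▸ hP.1.support_nodup
  have hch : (A ++ x :: B).IsChain G.Adj := hsupp ▸ P.isChain_adj_support
  simp only [List.isChain_append, List.isChain_cons, ha', hb, Option.mem_def,
    List.head?_cons, Option.some.injEq, forall_eq'] at hch
  obtain ⟨hA, ⟨hxb, hB⟩, hax⟩ := hch
  have hrev {l : List V} (hl : l.IsChain G.Adj) : l.reverse.IsChain G.Adj := by
    rw [List.isChain_reverse]
    exact hl.imp fun _ _ h => h.symm
  have key {l : List V} (hl : (q :: x :: l).IsChain G.Adj) (hperm : l.Perm (A ++ B)) : False := by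
    have hp : (q :: x :: l).Perm (q :: (A ++ x :: B)) :=
      ((hperm.cons x).trans List.perm_middle.symm).cons q
    have hle := hP.length_le_of_isChain hl
      (hp.nodup_iff.mpr (List.nodup_cons.mpr ⟨hsupp ▸ hq, hnd⟩))
    rw [hp.length_eq, ← hsupp, List.length_cons] at hle
    omega
  refine ⟨fun h => ?_, fun h => ?_, fun h => ?_⟩
  · refine key (l := B ++ A) ?_ List.perm_append_comm
    simp [List.isChain_cons, List.isChain_append, ha, hb, hb', hqx, hxb, hA, hB, h.symm]
  · refine key (l := A.reverse ++ B) ?_ (A.reverse_perm.append_right B)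
    simp [List.isChain_cons, List.isChain_append, ha, ha', hb, hqx, hrev hA, hB, h, hax.symm]
  · refine key (l := B ++ A.reverse) ?_
      (List.perm_append_comm.trans (A.reverse_perm.append_right B))
    simp [List.isChain_cons, List.isChain_append, ha', hb, hb', hqx, hrev hA, hB, h.symm, hxb]

theorem List.map_range_eq_append_cons {α : Type*} (f : ℕ → α) {m t : ℕ} (h : t < m) :
    (List.range m).map f =
      (List.range t).map f ++ f t :: (List.range (m - t - 1)).map (fun s => f (t + 1 + s)) := by
  obtain ⟨r, rfl⟩ : ∃ r, m = t + (r + 1) := ⟨m - t - 1, by omega⟩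
  rw [List.range_add, List.map_append, List.map_map, List.range_succ_eq_map]
  simp [Function.comp_def, Nat.add_comm, Nat.add_left_comm]


/-- forbidden pairs of vertices that cannot be joined by an edge of `Q`. -/
theorem statement12 {V : Type*} [Fintype V] (G : SimpleGraph V) (n : ℕ)
    (hcard : Fintype.card V = n)
    {u₁ v₁ u₂ v₂ : V} (P : G.Walk u₁ v₁) (Q : G.Walk u₂ v₂)
    (hP : IsLongestPath G P) (hQ : IsLongestPath G Q)
    (hcover : {x | x ∈ P.support} ∪ {x | x ∈ Q.support} = Set.univ)
    (p : ℕ → V)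
    (hsupp : P.support = (List.range (n - 1)).map (fun t => p (t + 1)))
    (i : ℕ) (hi1 : 1 < i) (hi2 : i < n - 1)
    (hPi : {x | x ∈ P.support} \ {x | x ∈ Q.support} = {p i})
    (q : V) (hq : {x | x ∈ Q.support} \ {x | x ∈ P.support} = {q})
    (hadj : G.Adj q (p i))
    (j k : ℕ) (hj1 : 1 < j) (hjk : j < k) (hk2 : k < n - 1)
    (hqj : s(q, p j) ∈ Q.edges) (hqk : s(q, p k) ∈ Q.edges)
    (hij : 1 < ((i : ℤ) - (j : ℤ)).natAbs)
    (hki : 1 < ((k : ℤ) - (i : ℤ)).natAbs)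
    (hkj : 1 < ((k : ℤ) - (j : ℤ)).natAbs) :
    s(p (i - 1), p (i + 1)) ∉ Q.edges ∧
    s(p 1, p (n - 1)) ∉ Q.edges ∧
    s(p 1, p (i + 1)) ∉ Q.edges ∧
    s(p (i - 1), p (n - 1)) ∉ Q.edges := by
  have hqP : q ∉ P.support := (hq.ge rfl : q ∈ _ \ _).2
  have hxQ : p i ∉ Q.support := (hPi.ge rfl : p i ∈ _ \ _).2
  obtain ⟨m, rfl⟩ : ∃ m, i = m + 2 := ⟨i - 2, by omega⟩
  obtain ⟨r, rfl⟩ : ∃ r, n = m + r + 4 := ⟨n - (m + 4), by omega⟩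
  have hsplit := List.map_range_eq_append_cons (fun t => p (t + 1))
    (show m + 1 < m + r + 4 - 1 by omega)
  rw [← hsupp] at hsplit
  have hch := P.isChain_adj_support
  rw [hsplit, show m + r + 4 - 1 - (m + 1) - 1 = r + 1 by omega] at hch
  rw [show m + r + 4 - 1 - (m + 1) - 1 = r + 1 by omega] at hsplit
  have hA' : ((List.range (m + 1)).map (fun t => p (t + 1))).getLast? = some (p (m + 1)) := by
    simp [List.getLast?_range]
  have hB : ((List.range (r + 1)).map (fun s => p (m + 1 + 1 + s + 1))).head? =
      some (p (m + 3)) := by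
    simp [List.head?_range]
  have hB' : ((List.range (r + 1)).map (fun s => p (m + 1 + 1 + s + 1))).getLast? =
      some (p (m + r + 3)) := by
    simp [List.getLast?_range]; congr 1; omega
  obtain ⟨h₁, h₂, h₃⟩ := hP.not_adj_of_support_eq hsplit hqP hadj
    (a := p 1) (by simp [List.head?_range]) hA' hB hB'
  simp only [List.isChain_append, List.isChain_cons, hA', hB, Option.mem_def,
    List.head?_cons, Option.some.injEq, forall_eq'] at hch
  obtain ⟨-, ⟨hxb, -⟩, hax⟩ := hch
  refine ⟨fun h => ?_, fun h => h₁ (Q.adj_of_mem_edges h), fun h => h₂ (Q.adj_of_mem_edges h),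
    fun h => h₃ (Q.adj_of_mem_edges h)⟩
  obtain ⟨R, hR, hlen, -⟩ := hQ.1.exists_isPath_length_succ_of_mem_edges hax hxb hxQ h
  have := hQ.2 R hR
  omega
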